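/- There cannot be an infinite sequence of consecutive execution steps in which no bad node is activated and no bad node becomes non-bad: any such sequence of steps has finite length. -/

import Mathlib

open scoped Classical

/-- A pre-configuration: a finite node set `V` with a partial parent map
(`none` means the node has no parent) and an integer height assignment. -/
structure PreConfig (V : Type*) where
  parent : V → Option V
  height : V → ℤ

namespace PreConfig

variable {V : Type*} [Fintype V] [LinearOrder V]

/-- The children of `u` are the nodes whose parent is `u`. -/
noncomputable def children (C : PreConfig V) (u : V) : Finset V :=
  Finset.univ.filter (fun v => C.parent v = some u)

/-- A leaf is a node with no children. -/
def IsLeaf (C : PreConfig V) (u : V) : Prop := C.children u = ∅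

/-- Maximum height value among the children of `u` (junk value `0` for a leaf). -/
noncomputable def maxH (C : PreConfig V) (u : V) : ℤ :=
  if h : (C.children u).Nonempty then (C.children u).sup' h C.height else 0

/-- Minimum height value among the children of `u` (junk value `0` for a leaf). -/
noncomputable def minH (C : PreConfig V) (u : V) : ℤ :=
  if h : (C.children u).Nonempty then (C.children u).inf' h C.height else 0

/-- A child of `u` of maximum height value; ties broken by a fixed rule
(smallest ID). Junk value `u` for a leaf. -/
noncomputable def maxChild (C : PreConfig V) (u : V) : V :=
  if h : ((C.children u).filter fun v => C.height v = C.maxH u).Nonempty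
  then ((C.children u).filter fun v => C.height v = C.maxH u).min' h else u

/-- A child of `u` of minimum height value; ties broken by a fixed rule
(smallest ID). Junk value `u` for a leaf. -/
noncomputable def minChild (C : PreConfig V) (u : V) : V :=
  if h : ((C.children u).filter fun v => C.height v = C.minH u).Nonempty
  then ((C.children u).filter fun v => C.height v = C.minH u).min' h else u

/-- `stable(u)`: `h(u) = 0` if `u` is a leaf, and `h(u) = 1 + max_{w child of u} h(w)` otherwise. -/
def Stable (C : PreConfig V) (u : V) : Prop :=
  (C.IsLeaf u ∧ C.height u = 0) ∨ (¬ C.IsLeaf u ∧ C.height u = 1 + C.maxH u)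

/-- `balanced(u)`: `|h(z) − h(z')| ≤ α` for all children `z, z'` of `u`. -/
def Balanced (α : ℤ) (C : PreConfig V) (u : V) : Prop :=
  ∀ z ∈ C.children u, ∀ z' ∈ C.children u, |C.height z - C.height z'| ≤ α

/-- `u` is enabled for a height update iff `¬stable(u)`. -/
def UpdateEnabled (C : PreConfig V) (u : V) : Prop := ¬ C.Stable u

/-- `u` is enabled for a swap iff `stable(u) ∧ stable(max(u)) ∧ ¬balanced(u)`. -/
def SwapEnabled (α : ℤ) (C : PreConfig V) (u : V) : Prop :=
  C.Stable u ∧ C.Stable (C.maxChild u) ∧ ¬ Balanced α C u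

/-- `u` is enabled iff it is enabled for a height update or for a swap. -/
def Enabled (α : ℤ) (C : PreConfig V) (u : V) : Prop :=
  C.UpdateEnabled u ∨ SwapEnabled α C u

/-- The value written by a height update: `0` for a leaf, `1 + max_{w child of u} h(w)` otherwise. -/
noncomputable def newHeight (C : PreConfig V) (u : V) : ℤ :=
  if C.IsLeaf u then 0 else 1 + C.maxH u

/-- A bad node: an internal node `u` with `h(u) ≤ max_{v child of u} h(v)`,
or a leaf `u` with `h(u) < 0`. -/
def Bad (C : PreConfig V) (u : V) : Prop :=
  (¬ C.IsLeaf u ∧ C.height u ≤ C.maxH u) ∨ (C.IsLeaf u ∧ C.height u < 0)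

/-- `v` reaches `a` by iterating the parent map. -/
def Reaches (C : PreConfig V) (v a : V) : Prop :=
  Relation.ReflTransGen (fun x y => C.parent x = some y) v a

/-- The underlying graph is a rooted tree with root `r`: `r` has no parent,
every other node has a (unique) parent, and every node reaches `r` by
iterating the parent map. -/
def IsTree (C : PreConfig V) (r : V) : Prop :=
  C.parent r = none ∧ (∀ v, C.parent v = none → v = r) ∧ ∀ v, C.Reaches v r

/-- The subtree `S_u` of `u`: the set of descendants of `u` (including `u`). -/
def subtree (C : PreConfig V) (u : V) : Set V := {v | C.Reaches v u}

/-- The actual height `h*(u)` of `u`: the length of a longest directed path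
going downward from `u` (such a maximal path necessarily ends at a leaf of `S_u`). -/
noncomputable def hstar (C : PreConfig V) (u : V) : ℕ :=
  sSup {n : ℕ | ∃ f : ℕ → V, f 0 = u ∧ ∀ i < n, C.parent (f (i + 1)) = some (f i)}

/-- An execution step `C →_A C'`: a nonempty set `A` of nodes enabled in `C` is
activated simultaneously; each `u ∈ A` enabled for a height update sets its height
to `newHeight`; each `u ∈ A` enabled for a swap replaces the edges `(u, min(u))` and
`(max(u), max(max(u)))` by `(u, max(max(u)))` and `(max(u), min(u))` (all guards and
functions evaluated in `C`); everything else is unchanged. -/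
structure Step (α : ℤ) (C C' : PreConfig V) (A : Finset V) : Prop where
  nonempty : A.Nonempty
  all_enabled : ∀ u ∈ A, Enabled α C u
  height_update : ∀ u ∈ A, C.UpdateEnabled u → C'.height u = C.newHeight u
  height_keep : ∀ u, ¬ (u ∈ A ∧ C.UpdateEnabled u) → C'.height u = C.height u
  swap_out : ∀ u ∈ A, SwapEnabled α C u → C'.parent (C.minChild u) = some (C.maxChild u)
  swap_in : ∀ u ∈ A, SwapEnabled α C u → C'.parent (C.maxChild (C.maxChild u)) = some u
  parent_keep : ∀ v, (∀ u ∈ A, SwapEnabled α C u →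
      v ≠ C.minChild u ∧ v ≠ C.maxChild (C.maxChild u)) → C'.parent v = C.parent v

end PreConfig

namespace PreConfig

variable {V : Type*} [Fintype V] [LinearOrder V]

theorem mem_children {C : PreConfig V} {u v : V} : v ∈ C.children u ↔ C.parent v = some u := by
  simp [children]

theorem height_le_maxH {C : PreConfig V} {u v : V} (hv : v ∈ C.children u) :
    C.height v ≤ C.maxH u := by
  rw [maxH, dif_pos ⟨v, hv⟩]
  exact Finset.le_sup' C.height hv

theorem minH_le_height {C : PreConfig V} {u v : V} (hv : v ∈ C.children u) :
    C.minH u ≤ C.height v := by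
  rw [minH, dif_pos ⟨v, hv⟩]
  exact Finset.inf'_le C.height hv

theorem nonempty_children_of_not_isLeaf {C : PreConfig V} {u : V} (hu : ¬ C.IsLeaf u) :
    (C.children u).Nonempty :=
  Finset.nonempty_iff_ne_empty.mpr hu

theorem maxChild_spec {C : PreConfig V} {u : V} (hu : ¬ C.IsLeaf u) :
    C.parent (C.maxChild u) = some u ∧ C.height (C.maxChild u) = C.maxH u := by
  have hne := nonempty_children_of_not_isLeaf hu
  have h : ((C.children u).filter fun v => C.height v = C.maxH u).Nonempty := by
    obtain ⟨v, hv, hvh⟩ := Finset.exists_mem_eq_sup' hne C.height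
    exact ⟨v, Finset.mem_filter.mpr ⟨hv, by rw [maxH, dif_pos hne, hvh]⟩⟩
  have hmem := Finset.min'_mem _ h
  rw [maxChild, dif_pos h]
  rw [Finset.mem_filter, mem_children] at hmem
  exact hmem

theorem minChild_spec {C : PreConfig V} {u : V} (hu : ¬ C.IsLeaf u) :
    C.parent (C.minChild u) = some u ∧ C.height (C.minChild u) = C.minH u := by
  have hne := nonempty_children_of_not_isLeaf hu
  have h : ((C.children u).filter fun v => C.height v = C.minH u).Nonempty := by
    obtain ⟨v, hv, hvh⟩ := Finset.exists_mem_eq_inf' hne C.height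
    exact ⟨v, Finset.mem_filter.mpr ⟨hv, by rw [minH, dif_pos hne, hvh]⟩⟩
  have hmem := Finset.min'_mem _ h
  rw [minChild, dif_pos h]
  rw [Finset.mem_filter, mem_children] at hmem
  exact hmem

theorem maxChild_of_isLeaf {C : PreConfig V} {u : V} (hu : C.IsLeaf u) : C.maxChild u = u := by
  have hu' : C.children u = ∅ := hu
  simp [maxChild, hu']

theorem Stable.height_of_isLeaf {C : PreConfig V} {u : V} (h : C.Stable u) (hu : C.IsLeaf u) :
    C.height u = 0 := by
  rcases h with h | h
  · exact h.2
  · exact absurd hu h.1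

theorem Stable.height_of_not_isLeaf {C : PreConfig V} {u : V} (h : C.Stable u)
    (hu : ¬ C.IsLeaf u) : C.height u = 1 + C.maxH u := by
  rcases h with h | h
  · exact absurd h.1 hu
  · exact h.2

theorem not_isLeaf_of_not_balanced {α : ℤ} {C : PreConfig V} {u : V} (h : ¬ Balanced α C u) :
    ¬ C.IsLeaf u := by
  intro hu
  have hu' : C.children u = ∅ := hu
  simp [Balanced, hu'] at h

theorem add_lt_maxH_of_not_balanced {α : ℤ} {C : PreConfig V} {u : V} (h : ¬ Balanced α C u) :
    C.minH u + α < C.maxH u := by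
  simp only [Balanced, not_forall, not_le] at h
  obtain ⟨z, hz, z', hz', hlt⟩ := h
  have := height_le_maxH hz
  have := height_le_maxH hz'
  have := minH_le_height hz
  have := minH_le_height hz'
  rcases lt_abs.mp hlt with h | h <;> linarith

/-- A height update of a node that is not bad strictly decreases its height. -/
theorem newHeight_lt {C : PreConfig V} {u : V} (hu : C.UpdateEnabled u) (hb : ¬ C.Bad u) :
    C.newHeight u < C.height u := by
  unfold UpdateEnabled Stable at hu
  unfold Bad at hb
  unfold newHeight
  by_cases hl : C.IsLeaf u
  · simp only [hl, true_and, not_true_eq_false, false_and, or_false, false_or, not_lt] at hu hb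
    simp only [hl, if_true]
    omega
  · simp only [hl, false_and, not_false_eq_true, true_and, false_or, or_false, not_le] at hu hb
    simp only [hl, if_false]
    omega

theorem le_newHeight {C : PreConfig V} {m : ℤ} (hm : m ≤ 0) (h : ∀ v, m ≤ C.height v) (u : V) :
    m ≤ C.newHeight u := by
  unfold newHeight
  split_ifs with hl
  · exact hm
  · have := h (C.maxChild u)
    rw [(maxChild_spec hl).2] at this
    omega

theorem Step.height_le {α : ℤ} {C C' : PreConfig V} {A : Finset V} (hs : Step α C C' A)
    (hb : ∀ u ∈ A, ¬ C.Bad u) (u : V) : C'.height u ≤ C.height u := by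
  by_cases hu : u ∈ A ∧ C.UpdateEnabled u
  · rw [hs.height_update u hu.1 hu.2]
    exact (newHeight_lt hu.2 (hb u hu.1)).le
  · exact (hs.height_keep u hu).le

theorem Step.le_height {α : ℤ} {C C' : PreConfig V} {A : Finset V} (hs : Step α C C' A)
    {m : ℤ} (hm : m ≤ 0) (h : ∀ v, m ≤ C.height v) (u : V) : m ≤ C'.height u := by
  by_cases hu : u ∈ A ∧ C.UpdateEnabled u
  · rw [hs.height_update u hu.1 hu.2]
    exact le_newHeight hm h u
  · rw [hs.height_keep u hu]
    exact h u

/-- If no bad node is activated and no height changes, then every activated node swaps. -/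
theorem Step.swapEnabled_of_height_eq {α : ℤ} {C C' : PreConfig V} {A : Finset V}
    (hs : Step α C C' A) (hb : ∀ u ∈ A, ¬ C.Bad u) (hh : C'.height = C.height) {u : V}
    (hu : u ∈ A) : SwapEnabled α C u := by
  refine (hs.all_enabled u hu).resolve_left fun hup => ?_
  have := newHeight_lt hup (hb u hu)
  rw [← hs.height_update u hu hup, hh] at this
  exact lt_irrefl _ this

/-- The height of the parent of `y`, or `0` if `y` has no parent. -/
def parentHeight (C : PreConfig V) (y : V) : ℤ := (C.parent y).elim 0 C.height

/-- The sum over all edges of the product of the heights of the endpoints. -/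
def edgePotential (C : PreConfig V) : ℤ := ∑ y, C.height y * C.parentHeight y

/-- A step that consists of swaps only strictly increases the edge potential. -/
theorem Step.edgePotential_lt {α : ℤ} (hα : 1 ≤ α) {C C' : PreConfig V} {A : Finset V}
    (hs : Step α C C' A) (hh : C'.height = C.height) (hsw : ∀ u ∈ A, SwapEnabled α C u) :
    C.edgePotential < C'.edgePotential := by
  have hleaf : ∀ u ∈ A, ¬ C.IsLeaf u := fun u hu => not_isLeaf_of_not_balanced (hsw u hu).2.2
  have hmax := fun u hu => maxChild_spec (hleaf u hu)
  have hmin := fun u hu => minChild_spec (hleaf u hu)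
  have hgap := fun u hu => add_lt_maxH_of_not_balanced (hsw u hu).2.2
  have hht := fun u hu => (hsw u hu).1.height_of_not_isLeaf (hleaf u hu)
  set B := A.filter fun u => ¬ C.IsLeaf (C.maxChild u) with hB
  have hBA : ∀ u ∈ B, u ∈ A := fun u hu => (Finset.mem_filter.mp hu).1
  have hmm := fun u (hu : u ∈ B) => maxChild_spec (Finset.mem_filter.mp hu).2
  have hmmht := fun u (hu : u ∈ B) =>
    (hsw u (hBA u hu)).2.1.height_of_not_isLeaf (Finset.mem_filter.mp hu).2
  set d : V → ℤ := fun y => C.height y * (C'.parentHeight y - C.parentHeight y) with hd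
  have hdmin : ∀ u ∈ A, d (C.minChild u) = - C.height (C.minChild u) := by
    intro u hu
    simp only [hd, parentHeight, hs.swap_out u hu (hsw u hu), (hmin u hu).1, Option.elim_some,
      hh, (hmax u hu).2, hht u hu]
    ring
  have hdmax : ∀ u ∈ B, d (C.maxChild (C.maxChild u)) = C.height (C.maxChild (C.maxChild u)) := by
    intro u hu
    have hu' := hBA u hu
    simp only [hd, parentHeight, hs.swap_in u hu' (hsw u hu'), (hmm u hu).1, Option.elim_some,
      hh, (hmax u hu').2, hht u hu']
    ring
  have hdisj : Disjoint (A.image C.minChild) (B.image fun u => C.maxChild (C.maxChild u)) := by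
    rw [Finset.disjoint_left]
    intro y hy hy'
    obtain ⟨u, hu, rfl⟩ := Finset.mem_image.mp hy
    obtain ⟨t, ht, he⟩ := Finset.mem_image.mp hy'
    have hp := (hmm t ht).1
    have hheight := (hmm t ht).2
    rw [he, (hmin u hu).1] at hp
    rw [he, (hmin u hu).2, ← Option.some.inj hp] at hheight
    have := hgap u hu
    omega
  have hzero : ∀ y, y ∉ A.image C.minChild ∪ B.image (fun u => C.maxChild (C.maxChild u)) →
      d y = 0 := by
    intro y hy
    have hpar : C'.parent y = C.parent y := by
      by_cases hmoved : ∃ u ∈ A, y = C.maxChild (C.maxChild u)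
      · obtain ⟨u, hu, rfl⟩ := hmoved
        have hl : C.IsLeaf (C.maxChild u) := by
          by_contra hl
          exact hy (Finset.mem_union_right _
            (Finset.mem_image_of_mem _ (Finset.mem_filter.mpr ⟨hu, hl⟩)))
        rw [hs.swap_in u hu (hsw u hu), maxChild_of_isLeaf hl, (hmax u hu).1]
      · refine hs.parent_keep y fun u hu _ => ⟨?_, fun h => hmoved ⟨u, hu, h⟩⟩
        rintro rfl
        exact hy (Finset.mem_union_left _ (Finset.mem_image_of_mem _ hu))
    simp [hd, parentHeight, hpar, hh]
  have hinjmin : Set.InjOn C.minChild A := by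
    intro u hu t ht he
    have h := (hmin u hu).1
    rw [he, (hmin t ht).1] at h
    exact (Option.some.inj h).symm
  have hinjmax : Set.InjOn (fun u => C.maxChild (C.maxChild u)) B := by
    intro u hu t ht he
    have h := (hmm u hu).1
    simp only at he
    rw [he, (hmm t ht).1] at h
    have h' := (hmax u (hBA u hu)).1
    rw [← Option.some.inj h, (hmax t (hBA t ht)).1] at h'
    exact (Option.some.inj h').symm
  have hsum : C'.edgePotential - C.edgePotential = ∑ u ∈ A, (- C.height (C.minChild u) +
      if ¬ C.IsLeaf (C.maxChild u) then C.height (C.maxChild (C.maxChild u)) else 0) := by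
    calc C'.edgePotential - C.edgePotential = ∑ y, d y := by
          simp only [edgePotential, hd, hh, mul_sub, Finset.sum_sub_distrib]
      _ = ∑ y ∈ A.image C.minChild ∪ B.image (fun u => C.maxChild (C.maxChild u)), d y :=
          (Finset.sum_subset (Finset.subset_univ _) fun y _ hy => hzero y hy).symm
      _ = _ := by
          rw [Finset.sum_union hdisj, Finset.sum_image hinjmin, Finset.sum_image hinjmax,
            Finset.sum_congr rfl hdmin, Finset.sum_congr rfl hdmax, Finset.sum_add_distrib,
            hB, Finset.sum_filter]
  have hpos : 0 < C'.edgePotential - C.edgePotential := by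
    rw [hsum]
    refine Finset.sum_pos (fun u hu => ?_) hs.nonempty
    have h1 := hgap u hu
    have h2 := (hmin u hu).2
    have h3 := (hmax u hu).2
    split_ifs with hl
    · have h4 := (hsw u hu).2.1.height_of_isLeaf hl
      omega
    · have hu' : u ∈ B := Finset.mem_filter.mpr ⟨hu, hl⟩
      have h4 := hmmht u hu'
      have h5 := (hmm u hu').2
      omega
  omega

end PreConfig

/-- There cannot be an infinite sequence of consecutive execution steps
in which no bad node is activated and no bad node becomes non-bad. -/
theorem stmt7 {V : Type*} [Fintype V] [LinearOrder V] (α : ℤ) (hα : 1 ≤ α)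
    (Cs : ℕ → PreConfig V) (As : ℕ → Finset V) (r : V)
    (hT : (Cs 0).IsTree r)
    (hstep : ∀ n, PreConfig.Step α (Cs n) (Cs (n + 1)) (As n))
    (hnoact : ∀ n, ∀ u ∈ As n, ¬ (Cs n).Bad u)
    (hkeep : ∀ n u, (Cs n).Bad u → (Cs (n + 1)).Bad u) :
    False := by
  have hle : ∀ n u, (Cs (n + 1)).height u ≤ (Cs n).height u := fun n =>
    (hstep n).height_le (hnoact n)
  obtain ⟨m, hm0, hm⟩ : ∃ m : ℤ, m ≤ 0 ∧ ∀ n u, m ≤ (Cs n).height u := by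
    obtain ⟨b, hb⟩ := (Set.finite_range (Cs 0).height).bddBelow
    refine ⟨min b 0, min_le_right _ _, fun n => ?_⟩
    induction n with
    | zero => exact fun u => (min_le_left _ _).trans (hb ⟨u, rfl⟩)
    | succ n ih => exact (hstep n).le_height (min_le_right _ _) ih
  obtain ⟨N, hN⟩ : ∃ N, ∀ n, N ≤ n → (Cs (n + 1)).height = (Cs n).height := by
    let S : ℕ → ℕ := fun n => ∑ u, ((Cs n).height u - m).toNat
    have hterm : ∀ n u, ((Cs (n + 1)).height u - m).toNat ≤ ((Cs n).height u - m).toNat :=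
      fun n u => Int.toNat_le_toNat (sub_le_sub_right (hle n u) m)
    have hS : Antitone S := antitone_nat_of_succ_le fun n =>
      Finset.sum_le_sum fun u _ => hterm n u
    refine ⟨Function.argmin S, fun n hn => funext fun u => ?_⟩
    have hSn : S (n + 1) = S n :=
      le_antisymm (hS n.le_succ) ((hS hn).trans (Function.argmin_le S (n + 1)))
    have := (Finset.sum_eq_sum_iff_of_le fun u _ => hterm n u).mp hSn u (Finset.mem_univ u)
    have := hm n u
    have := hm (n + 1) u
    omega
  have hheight : ∀ k, (Cs (N + k)).height = (Cs N).height := by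
    intro k
    induction k with
    | zero => rfl
    | succ k ih => exact (hN (N + k) (N.le_add_right k)).trans ih
  have hmono : StrictMono fun k => (Cs (N + k)).edgePotential := strictMono_nat_of_lt_succ fun k =>
    have hh := hN (N + k) (N.le_add_right k)
    (hstep (N + k)).edgePotential_lt hα hh fun _ hu =>
      (hstep (N + k)).swapEnabled_of_height_eq (hnoact (N + k)) hh hu
  refine not_injective_infinite_finite (fun k => (Cs (N + k)).parent) fun k l hkl => ?_
  refine hmono.injective ?_
  simp only at hkl
  simp only [PreConfig.edgePotential, PreConfig.parentHeight, hkl, hheight]
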